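/- Let Φ ▷^(b,e,r) Γ ⊢ t : τ be a typing derivation in system ℓ. Then: (1) if neutral_x(t) then x ∈ dom(Γ), and moreover if Γ(x) is a tight multiset then τ is a tight type and dom(Γ) = {x}; (2) if normal_x(t) then x ∈ dom(Γ), and moreover if Γ(x) is a tight multiset then dom(Γ) = {x}; (3) if normal°(t) and τ is a tight type, then τ = abs and Γ is the empty typing context. -/

import Mathlib

/-! Linear substitution calculus (LSC) and the multi type system ℓ. -/

namespace LSC

/-- Terms of the linear substitution calculus:
variables, abstractions, applications and explicit substitutions `t[x\u]`. -/
inductive Term : Type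
  | var : ℕ → Term
  | lam : ℕ → Term → Term
  | app : Term → Term → Term
  | es  : Term → ℕ → Term → Term

/-- Free variables of a term. -/
def fv : Term → Finset ℕ
  | Term.var x => {x}
  | Term.lam x t => fv t \ {x}
  | Term.app t u => fv t ∪ fv u
  | Term.es t x u => (fv t \ {x}) ∪ fv u

/-- Multi types: the two tight constants and arrow types whose source is a
finite multiset (represented as a list) of multi types. -/
inductive Ty : Type
  | neutral : Ty
  | abs : Ty
  | arrow : List Ty → Ty → Ty

/-- A type is tight when it is one of the two tight constants. -/
def tightTy (τ : Ty) : Prop := τ = Ty.neutral ∨ τ = Ty.abs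

/-- A multiset of types is tight when all its elements are tight. -/
def tightM (M : List Ty) : Prop := ∀ τ ∈ M, tightTy τ

/-- Typing contexts: maps from variables to finite multisets of types
(the empty multiset meaning that the variable is not in the domain). -/
def Ctx : Type := ℕ → List Ty

/-- Multiset union of typing contexts. -/
def Ctx.union (Γ Δ : Ctx) : Ctx := fun x => Γ x ++ Δ x

/-- Removing a variable from a typing context. -/
def Ctx.erase (Γ : Ctx) (x : ℕ) : Ctx := fun y => if y = x then [] else Γ y

/-- The typing context `x : M`. -/
def Ctx.single (x : ℕ) (M : List Ty) : Ctx := fun y => if y = x then M else []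

/-- The empty typing context. -/
def Ctx.empty : Ctx := fun _ => []

/-- A typing context is tight when all its multisets are tight. -/
def tightCtx (Γ : Ctx) : Prop := ∀ x, tightM (Γ x)

mutual
  /-- The type system ℓ: `Deriv Γ t τ b e r s` means that there is a typing
  derivation `Φ ▷^(b,e,r) Γ ⊢ t : τ` whose size (number of rules, not counting
  occurrences of the rule `many`) is `s`.  The index `r − |M|` of the rules
  `λ_b` and `ES` is rendered by writing the premise index as `r + |M|`. -/
  inductive Deriv : Ctx → Term → Ty → ℕ → ℕ → ℕ → ℕ → Prop
    | ax {x : ℕ} {τ : Ty} :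
        Deriv (Ctx.single x [τ]) (Term.var x) τ 0 0 1 1
    | lamB {Γ : Ctx} {x : ℕ} {t : Term} {τ : Ty} {b e r s : ℕ} :
        Deriv Γ t τ b e (r + (Γ x).length) s →
        Deriv (Γ.erase x) (Term.lam x t) (Ty.arrow (Γ x) τ)
          (b + 1) (e + (Γ x).length) r (s + 1)
    | lamR {Γ : Ctx} {x : ℕ} {t : Term} {τ : Ty} {b e r s : ℕ} :
        tightM (Γ x) → tightTy τ →
        Deriv Γ t τ b e r s →
        Deriv (Γ.erase x) (Term.lam x t) Ty.abs b e (r + 1) (s + 1)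
    | appB {Γ Δ : Ctx} {t u : Term} {M : List Ty} {τ : Ty} {b e r s b' e' r' s' : ℕ} :
        Deriv Γ t (Ty.arrow M τ) b e r s →
        DerivM Δ u M b' e' r' s' →
        Deriv (Γ.union Δ) (Term.app t u) τ (b + b' + 1) (e + e') (r + r') (s + s' + 1)
    | appR {Γ : Ctx} {t u : Term} {b e r s : ℕ} :
        Deriv Γ t Ty.neutral b e r s →
        Deriv Γ (Term.app t u) Ty.neutral b e (r + 1) (s + 1)
    | esR {Γ Δ : Ctx} {t : Term} {x : ℕ} {u : Term} {τ : Ty} {b e r s b' e' r' s' : ℕ} :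
        Deriv Γ t τ b e (r + (Γ x).length) s →
        DerivM Δ u (Γ x) b' e' r' s' →
        Deriv ((Γ.erase x).union Δ) (Term.es t x u) τ
          (b + b') (e + e' + (Γ x).length) (r + r') (s + s' + 1)

  /-- The rule `many`: a finite family of derivations typing the same term is
  merged, summing contexts and indices, to type it with the multiset of the types. -/
  inductive DerivM : Ctx → Term → List Ty → ℕ → ℕ → ℕ → ℕ → Prop
    | nil {t : Term} : DerivM Ctx.empty t [] 0 0 0 0
    | cons {Γ Δ : Ctx} {t : Term} {τ : Ty} {M : List Ty} {b e r s b' e' r' s' : ℕ} :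
        Deriv Γ t τ b e r s →
        DerivM Δ t M b' e' r' s' →
        DerivM (Γ.union Δ) t (τ :: M) (b + b') (e + e') (r + r') (s + s')
end

/-- `NeutralAt x t`: the predicate `neutral_x(t)` (linear head neutral with head
variable `x`). -/
inductive NeutralAt : ℕ → Term → Prop
  | var (x : ℕ) : NeutralAt x (Term.var x)
  | app {x : ℕ} {t : Term} (u : Term) : NeutralAt x t → NeutralAt x (Term.app t u)
  | es {x y : ℕ} {t : Term} (u : Term) : NeutralAt x t → y ≠ x →
      NeutralAt x (Term.es t y u)

/-- `NormalAt x t`: the predicate `normal_x(t)` (linear head normal with free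
head variable `x`). -/
inductive NormalAt : ℕ → Term → Prop
  | neutral {x : ℕ} {t : Term} : NeutralAt x t → NormalAt x t
  | lam {x y : ℕ} {t : Term} : NormalAt x t → y ≠ x → NormalAt x (Term.lam y t)
  | es {x y : ℕ} {t : Term} (u : Term) : NormalAt x t → y ≠ x →
      NormalAt x (Term.es t y u)

/-- `NormalO t`: the predicate `normal°(t)` (linear head normal with bound head
variable). -/
inductive NormalO : Term → Prop
  | lamAt {x : ℕ} {t : Term} : NormalAt x t → NormalO (Term.lam x t)
  | lamO {x : ℕ} {t : Term} : NormalO t → NormalO (Term.lam x t)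
  | es {y : ℕ} {t : Term} (u : Term) : NormalO t → NormalO (Term.es t y u)

/-- Linear head normal forms. -/
def NormalLH (t : Term) : Prop := (∃ x, NormalAt x t) ∨ NormalO t

/-- Linear head neutral terms. -/
def NeutralLH (t : Term) : Prop := ∃ x, NeutralAt x t

/-- Linear head abstractions (`abs_ℓh`), i.e. abstractions modulo ES. -/
inductive AbsLH : Term → Prop
  | lam {x : ℕ} {t : Term} : AbsLH (Term.lam x t)
  | es {x : ℕ} {t u : Term} : AbsLH t → AbsLH (Term.es t x u)

/-- Linear head size. -/
def lhSize : Term → ℕ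
  | Term.var _ => 1
  | Term.lam _ t => lhSize t + 1
  | Term.app t _ => lhSize t + 1
  | Term.es t _ _ => lhSize t

/-- Linear head contexts `H ::= ⟨·⟩ | λx.H | H t | H[x\t]`. -/
inductive HCtx : Type
  | hole : HCtx
  | lam : ℕ → HCtx → HCtx
  | app : HCtx → Term → HCtx
  | es : HCtx → ℕ → Term → HCtx

/-- Plugging a term in a linear head context. -/
def HCtx.plug : HCtx → Term → Term
  | HCtx.hole, t => t
  | HCtx.lam x H, t => Term.lam x (H.plug t)
  | HCtx.app H u, t => Term.app (H.plug t) u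
  | HCtx.es H x u, t => Term.es (H.plug t) x u

/-- The variables that a linear head context can capture. -/
def HCtx.binders : HCtx → Finset ℕ
  | HCtx.hole => ∅
  | HCtx.lam x H => insert x H.binders
  | HCtx.app H _ => H.binders
  | HCtx.es H x _ => insert x H.binders

/-- Substitution contexts `L ::= ⟨·⟩ | L[x\t]`. -/
inductive LCtx : Type
  | hole : LCtx
  | es : LCtx → ℕ → Term → LCtx

/-- Plugging a term in a substitution context. -/
def LCtx.plug : LCtx → Term → Term
  | LCtx.hole, t => t
  | LCtx.es L x u, t => Term.es (L.plug t) x u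

/-- `t` is of the form `H⟨x⟩` with `x` not captured by `H`. -/
def IsHeadVarOf (x : ℕ) (t : Term) : Prop :=
  ∃ H : HCtx, x ∉ H.binders ∧ t = H.plug (Term.var x)

/-- Multiplicative evaluation `→m`. -/
inductive MStep : Term → Term → Prop
  | beta {L : LCtx} {x : ℕ} {t u : Term} :
      MStep (Term.app (L.plug (Term.lam x t)) u) (L.plug (Term.es t x u))
  | lam {x : ℕ} {t t' : Term} : MStep t t' → MStep (Term.lam x t) (Term.lam x t')
  | app {t t' u : Term} : ¬ AbsLH t → MStep t t' →
      MStep (Term.app t u) (Term.app t' u)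
  | es {t t' u : Term} {x : ℕ} : ¬ IsHeadVarOf x t → MStep t t' →
      MStep (Term.es t x u) (Term.es t' x u)

/-- Exponential evaluation `→e`. -/
inductive EStep : Term → Term → Prop
  | sub {H : HCtx} {x : ℕ} {u : Term} :
      x ∉ H.binders → (∀ y ∈ fv u, y ∉ H.binders) →
      EStep (Term.es (H.plug (Term.var x)) x u) (Term.es (H.plug u) x u)
  | lam {x : ℕ} {t t' : Term} : EStep t t' → EStep (Term.lam x t) (Term.lam x t')
  | app {t t' u : Term} : ¬ AbsLH t → EStep t t' →
      EStep (Term.app t u) (Term.app t' u)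
  | es {t t' u : Term} {x : ℕ} : ¬ IsHeadVarOf x t → EStep t t' →
      EStep (Term.es t x u) (Term.es t' x u)

/-- Linear head evaluation `→ℓh` is the union of `→m` and `→e`. -/
def LHStep (t u : Term) : Prop := MStep t u ∨ EStep t u

/-- `Steps R k t u`: `t` evaluates to `u` in exactly `k` `R`-steps. -/
def Steps (R : Term → Term → Prop) : ℕ → Term → Term → Prop
  | 0, t, u => t = u
  | k + 1, t, u => ∃ p, R t p ∧ Steps R k p u

/-- `MESteps k₁ k₂ t u`: an evaluation sequence from `t` to `u` made of `k₁`
multiplicative steps and `k₂` exponential steps. -/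
inductive MESteps : ℕ → ℕ → Term → Term → Prop
  | refl (t : Term) : MESteps 0 0 t t
  | mstep {t p u : Term} {k₁ k₂ : ℕ} : MStep t p → MESteps k₁ k₂ p u →
      MESteps (k₁ + 1) k₂ t u
  | estep {t p u : Term} {k₁ k₂ : ℕ} : EStep t p → MESteps k₁ k₂ p u →
      MESteps k₁ (k₂ + 1) t u


theorem DerivM.ctx_eq_nil {Δ : Ctx} {u : Term} {b e r s : ℕ}
    (h : DerivM Δ u [] b e r s) (y : ℕ) : Δ y = [] := by
  cases h
  rfl

theorem tightM.of_append_left {M N : List Ty} (h : tightM (M ++ N)) : tightM M :=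
  fun σ hσ => h σ (List.mem_append_left N hσ)

theorem not_tightTy_arrow (M : List Ty) (τ : Ty) : ¬ tightTy (Ty.arrow M τ) := by
  simp [tightTy]

theorem Ctx.erase_of_ne (Γ : Ctx) {x y : ℕ} (h : y ≠ x) : Γ.erase y x = Γ x :=
  if_neg h.symm

/-- The only variable in the domain of `Γ` is `x`. -/
def Ctx.DomSubset (Γ : Ctx) (x : ℕ) : Prop := ∀ y, Γ y ≠ [] → y = x

theorem Ctx.DomSubset.erase {Γ : Ctx} {x : ℕ} (h : Γ.DomSubset x) (y : ℕ) :
    (Γ.erase y).DomSubset x := by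
  intro z hz
  refine h z fun h0 => hz ?_
  simp [Ctx.erase, h0]

theorem Ctx.DomSubset.eq_nil {Γ : Ctx} {x y : ℕ} (h : Γ.DomSubset x) (hy : y ≠ x) :
    Γ y = [] :=
  not_not.1 fun h0 => hy (h y h0)

theorem Ctx.union_erase_of_ne (Γ Δ : Ctx) {x y : ℕ} (h : y ≠ x) :
    (Γ.erase y).union Δ x = Γ x ++ Δ x := by
  simp [Ctx.union, Ctx.erase_of_ne Γ h]

/-- An explicit substitution on a variable outside the domain adds nothing to the context. -/
theorem Ctx.DomSubset.union_erase {Γ Δ : Ctx} {x y : ℕ} {u : Term} {b e r s : ℕ}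
    (h : Γ.DomSubset x) (hy : y ≠ x) (hΔ : DerivM Δ u (Γ y) b e r s) :
    ((Γ.erase y).union Δ).DomSubset x := by
  rw [h.eq_nil hy] at hΔ
  intro z hz
  refine h.erase y z fun h0 => hz ?_
  simp [Ctx.union, h0, hΔ.ctx_eq_nil z]

theorem NeutralAt.tight_spreading {x : ℕ} {t : Term} (h : NeutralAt x t) :
    ∀ {Γ : Ctx} {τ : Ty} {b e r s : ℕ}, Deriv Γ t τ b e r s →
      Γ x ≠ [] ∧ (tightM (Γ x) → tightTy τ ∧ Γ.DomSubset x) := by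
  induction h with
  | var =>
    intro Γ τ b e r s Φ
    cases Φ
    refine ⟨by simp [Ctx.single], fun ht => ⟨ht τ (by simp [Ctx.single]), fun y hy => ?_⟩⟩
    by_contra hne
    exact hy (if_neg hne)
  | app u _ ih =>
    intro Γ τ b e r s Φ
    cases Φ with
    | appB Φt Φu =>
      obtain ⟨hne, htight⟩ := ih Φt
      exact ⟨by simp [Ctx.union, hne], fun ht =>
        absurd (htight (tightM.of_append_left ht)).1 (not_tightTy_arrow _ _)⟩
    | appR Φt =>
      obtain ⟨hne, htight⟩ := ih Φt
      exact ⟨hne, fun ht => ⟨Or.inl rfl, (htight ht).2⟩⟩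
  | es u _ hy ih =>
    intro Γ τ b e r s Φ
    cases Φ with
    | esR Φt Φu =>
      obtain ⟨hne, htight⟩ := ih Φt
      rw [Ctx.union_erase_of_ne _ _ hy]
      refine ⟨by simp [hne], fun ht => ?_⟩
      obtain ⟨hτ, hdom⟩ := htight (tightM.of_append_left ht)
      exact ⟨hτ, hdom.union_erase hy Φu⟩

theorem NormalAt.domSubset_of_tightM {x : ℕ} {t : Term} (h : NormalAt x t) :
    ∀ {Γ : Ctx} {τ : Ty} {b e r s : ℕ}, Deriv Γ t τ b e r s →
      Γ x ≠ [] ∧ (tightM (Γ x) → Γ.DomSubset x) := by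
  induction h with
  | neutral h =>
    intro Γ τ b e r s Φ
    exact ⟨(h.tight_spreading Φ).1, fun ht => ((h.tight_spreading Φ).2 ht).2⟩
  | lam _ hy ih =>
    intro Γ τ b e r s Φ
    cases Φ with
    | lamB Φt | lamR _ _ Φt =>
      rw [Ctx.erase_of_ne _ hy]
      exact ⟨(ih Φt).1, fun ht => ((ih Φt).2 ht).erase _⟩
  | es u _ hy ih =>
    intro Γ τ b e r s Φ
    cases Φ with
    | esR Φt Φu =>
      obtain ⟨hne, htight⟩ := ih Φt
      rw [Ctx.union_erase_of_ne _ _ hy]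
      exact ⟨by simp [hne], fun ht =>
        (htight (tightM.of_append_left ht)).union_erase hy Φu⟩

theorem NormalO.eq_abs_and_ctx_eq_nil {t : Term} (h : NormalO t) :
    ∀ {Γ : Ctx} {τ : Ty} {b e r s : ℕ}, Deriv Γ t τ b e r s → tightTy τ →
      τ = Ty.abs ∧ ∀ y, Γ y = [] := by
  induction h with
  | @lamAt x t h =>
    intro Γ τ b e r s Φ hτ
    cases Φ with
    | lamB _ => exact absurd hτ (not_tightTy_arrow _ _)
    | lamR hM _ Φt =>
      refine ⟨rfl, fun y => ?_⟩
      by_cases hy : y = x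
      · simp [Ctx.erase, hy]
      · simp [Ctx.erase, ((h.domSubset_of_tightM Φt).2 hM).eq_nil hy]
  | lamO _ ih =>
    intro Γ τ b e r s Φ hτ
    cases Φ with
    | lamB _ => exact absurd hτ (not_tightTy_arrow _ _)
    | lamR _ hσ Φt => exact ⟨rfl, fun y => by simp [Ctx.erase, (ih Φt hσ).2 y]⟩
  | es u _ ih =>
    intro Γ τ b e r s Φ hτ
    cases Φ with
    | esR Φt Φu =>
      obtain ⟨hτ', hnil⟩ := ih Φt hτ
      rw [hnil] at Φu
      exact ⟨hτ', fun y => by simp [Ctx.union, Ctx.erase, hnil y, Φu.ctx_eq_nil y]⟩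

/-- Tight spreading on neutral terms, plus typing contexts (system ℓ). -/
theorem tight_spreading_neutral_lsc
    {Γ : Ctx} {t : Term} {τ : Ty} {b e r s : ℕ}
    (Φ : Deriv Γ t τ b e r s) :
    (∀ x, NeutralAt x t →
      Γ x ≠ [] ∧
      (tightM (Γ x) → tightTy τ ∧ ∀ y, Γ y ≠ [] → y = x)) ∧
    (∀ x, NormalAt x t →
      Γ x ≠ [] ∧
      (tightM (Γ x) → ∀ y, Γ y ≠ [] → y = x)) ∧
    (NormalO t → tightTy τ → τ = Ty.abs ∧ ∀ y, Γ y = []) := by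
  exact ⟨fun _ h => h.tight_spreading Φ, fun _ h => h.domSubset_of_tightM Φ,
    fun h => h.eq_abs_and_ctx_eq_nil Φ⟩

end LSC
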